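/- For adjacent indices i and j ≡ i+1 (mod l+1), the automorphisms satisfy the braid relation on every generator: s_i(s_j(s_i(x))) = s_j(s_i(s_j(x))) for each x ∈ {a_0,…,a_l, f_0,…,f_l}. -/

import Mathlib

open MvPolynomial

/-- The field `F_cl = ℂ(a_0,…,a_l, f_0,…,f_l)` of rational functions in
`2(l+1)` commuting indeterminates. -/
abbrev Fcl (l : ℕ) : Type :=
  FractionRing (MvPolynomial (Fin (l + 1) ⊕ Fin (l + 1)) ℂ)

/-- The generator `a_j` of `F_cl`. -/
noncomputable def av (l : ℕ) (j : Fin (l + 1)) : Fcl l :=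
  algebraMap (MvPolynomial (Fin (l + 1) ⊕ Fin (l + 1)) ℂ) (Fcl l) (X (Sum.inl j))

/-- The generator `f_j` of `F_cl`. -/
noncomputable def fv (l : ℕ) (j : Fin (l + 1)) : Fcl l :=
  algebraMap (MvPolynomial (Fin (l + 1) ⊕ Fin (l + 1)) ℂ) (Fcl l) (X (Sum.inr j))

/-- The generalized Cartan matrix of affine type `A_l^(1)` (indices mod `l+1`). -/
def cartanA (l : ℕ) (i j : Fin (l + 1)) : ℤ :=
  if i = j then 2 else if j = i + 1 ∨ i = j + 1 then -1 else 0

/-- `u_{ij} = 1` if `j ≡ i+1`, `-1` if `j ≡ i-1`, `0` otherwise. -/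
def uA (l : ℕ) (i j : Fin (l + 1)) : ℤ :=
  if j = i + 1 then 1 else if i = j + 1 then -1 else 0

/-- A polynomial with a nonvanishing value is nonzero in the fraction field. -/
theorem algebraMap_ne_zero_of_eval_ne_zero {l : ℕ}
    (p : MvPolynomial (Fin (l + 1) ⊕ Fin (l + 1)) ℂ) (x : Fin (l + 1) ⊕ Fin (l + 1) → ℂ)
    (h : MvPolynomial.eval x p ≠ 0) :
    algebraMap (MvPolynomial (Fin (l + 1) ⊕ Fin (l + 1)) ℂ) (Fcl l) p ≠ 0 := by
  intro h0
  rw [map_eq_zero_iff _ (IsFractionRing.injective _ _)] at h0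
  exact h (by rw [h0, map_zero])

theorem av_ne_zero (l : ℕ) (i : Fin (l + 1)) : av l i ≠ 0 :=
  algebraMap_ne_zero_of_eval_ne_zero _ (fun _ => 1) (by simp)

theorem fv_ne_zero (l : ℕ) (i : Fin (l + 1)) : fv l i ≠ 0 :=
  algebraMap_ne_zero_of_eval_ne_zero _ (fun _ => 1) (by simp)

theorem av_add_fv_ne_zero (l : ℕ) (i : Fin (l + 1)) : av l i + fv l i ≠ 0 := by
  rw [av, fv, ← map_add]
  exact algebraMap_ne_zero_of_eval_ne_zero _ (fun _ => 1) (by norm_num)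

theorem one_add_av_mul_fv_ne_zero (l : ℕ) (i : Fin (l + 1)) : 1 + av l i * fv l i ≠ 0 := by
  rw [av, fv, ← map_mul, ← map_one (algebraMap (MvPolynomial (Fin (l + 1) ⊕ Fin (l + 1)) ℂ) (Fcl l)), ← map_add]
  exact algebraMap_ne_zero_of_eval_ne_zero _ (fun _ => 1) (by norm_num)

/-- Rank-two identity behind the braid relation. -/
theorem ratio_mul_map_map_ratio {K : Type*} [Field K] (σ τ : K →+* K) {a b f g : K}
    (ha : a ≠ 0) (hb : b ≠ 0)
    (h₂ : 1 + a * f ≠ 0) (h₃ : b + g ≠ 0)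
    (σa : σ a = a⁻¹) (σb : σ b = b * a) (σf : σ f = f)
    (σg : σ g = g * ((a + f) / (1 + a * f)))
    (τa : τ a = a * b) (τf : τ f = f * ((b + g) / (1 + b * g))⁻¹) :
    (a + f) / (1 + a * f) * σ (τ ((a + f) / (1 + a * f))) = τ ((a + f) / (1 + a * f)) := by
  obtain ⟨v, hv⟩ : ∃ v, v = 1 + a * f := ⟨_, rfl⟩
  obtain ⟨w, hw⟩ : ∃ w, w = b + g := ⟨_, rfl⟩
  obtain ⟨z, hz⟩ : ∃ z, z = 1 + b * g := ⟨_, rfl⟩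
  obtain ⟨N, hN⟩ : ∃ N, N = b * a * v + g * (a + f) := ⟨_, rfl⟩
  obtain ⟨M, hM⟩ : ∃ M, M = v + b * a * g * (a + f) := ⟨_, rfl⟩
  rw [← hv] at h₂ σg ⊢
  rw [← hw] at h₃ τf
  rw [← hz] at τf
  have σw : σ w = N / v := by
    rw [hw, hN, map_add, σb, σg]
    field_simp
  have σz : σ z = M / v := by
    rw [hz, hM, map_add, map_mul, map_one, σb, σg]
    field_simp
  have hN₀ : N ≠ 0 := fun h => (map_ne_zero σ).2 h₃ (by rw [σw, h, zero_div])
  have στa : σ (τ a) = b := by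
    rw [τa, map_mul, σa, σb]
    field_simp
  have στf : σ (τ f) = f * M / N := by
    rw [τf, map_mul, map_inv₀, map_div₀, σf, σw, σz]
    field_simp
  have τv : τ v = (w + a * b * f * z) / w := by
    rw [hv, map_add, map_mul, map_one, τa, τf]
    field_simp
  have στv : σ (τ v) = (N + b * f * M) / N := by
    rw [hv, map_add, map_add, map_mul, map_mul, map_one, map_one, στa, στf]
    field_simp
  have hD : w + a * b * f * z ≠ 0 := fun h => (map_ne_zero τ).2 h₂ (by rw [τv, h, zero_div])
  have hE : N + b * f * M ≠ 0 :=
    fun h => (map_ne_zero σ).2 ((map_ne_zero τ).2 h₂) (by rw [στv, h, zero_div])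
  have τu : τ (a + f) = (a * b * w + f * z) / w := by
    rw [map_add, τa, τf]
    field_simp
  have στu : σ (τ (a + f)) = (b * N + f * M) / N := by
    rw [map_add, map_add, στa, στf]
    field_simp
  rw [map_div₀, map_div₀, στu, στv, τu, τv, div_div_div_cancel_right₀ hN₀,
    div_div_div_cancel_right₀ h₃, div_mul_div_comm, div_eq_div_iff (mul_ne_zero h₂ hE) hD,
    hN, hM, hv, hw, hz]
  ring

/-- The variant of `ratio_mul_map_map_ratio` with the two exponents exchanged; it follows by
inverting `f`. -/
theorem ratio_mul_map_map_ratio' {K : Type*} [Field K] (σ τ : K →+* K) {a b f g : K}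
    (ha : a ≠ 0) (hb : b ≠ 0) (hf : f ≠ 0)
    (h₁ : a + f ≠ 0) (h₃ : b + g ≠ 0)
    (σa : σ a = a⁻¹) (σb : σ b = b * a) (σf : σ f = f)
    (σg : σ g = g * ((a + f) / (1 + a * f))⁻¹)
    (τa : τ a = a * b) (τf : τ f = f * ((b + g) / (1 + b * g))) :
    (a + f) / (1 + a * f) * σ (τ ((a + f) / (1 + a * f))) = τ ((a + f) / (1 + a * f)) := by
  have inv_ratio : ∀ {x y : K}, y ≠ 0 →
      (x + y⁻¹) / (1 + x * y⁻¹) = ((x + y) / (1 + x * y))⁻¹ := by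
    intro x y hy
    rw [inv_div, ← mul_div_mul_right _ _ hy, add_mul, add_mul, inv_mul_cancel_right₀ hy,
      inv_mul_cancel₀ hy, one_mul, add_comm (x * y), add_comm y]
  have one_add_ne : ∀ {x y : K}, y ≠ 0 → x + y ≠ 0 → 1 + x * y⁻¹ ≠ 0 := by
    intro x y hy h h'
    apply h
    field_simp at h'
    linear_combination h'
  have h := ratio_mul_map_map_ratio σ τ (f := f⁻¹) ha hb
    (one_add_ne hf h₁) h₃ σa σb
    (by rw [map_inv₀, σf]) (by rw [σg, inv_ratio hf])
    τa (by rw [map_inv₀, τf, mul_inv])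
  rw [inv_ratio hf, map_inv₀, map_inv₀, ← mul_inv] at h
  exact inv_injective h

theorem Fin.ne_add_one_add_one {l : ℕ} (hl : 2 ≤ l) (i : Fin (l + 1)) : i ≠ i + 1 + 1 := by
  intro h
  rw [add_assoc, left_eq_add, Fin.ext_iff, Fin.val_add, Fin.val_one', Fin.val_zero,
    Nat.mod_eq_of_lt (by omega : 1 < l + 1), Nat.mod_eq_of_lt (by omega)] at h
  omega

theorem Fin.ne_add_one {l : ℕ} (hl : 1 ≤ l) (i : Fin (l + 1)) : i ≠ i + 1 := by
  intro h
  rw [left_eq_add, Fin.ext_iff, Fin.val_one', Fin.val_zero,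
    Nat.mod_eq_of_lt (by omega)] at h
  omega

/-- for adjacent indices `i` and `j = i+1` (mod `l+1`), the
automorphisms `s_i` satisfy the braid relation on every generator. -/
theorem KNY_braid_relation (l : ℕ) (hl : 2 ≤ l)
    (s : Fin (l + 1) → (Fcl l →+* Fcl l))
    (hsa : ∀ i j, s i (av l j) = av l j * av l i ^ (-(cartanA l i j)))
    (hsf : ∀ i j, s i (fv l j) =
      fv l j * ((av l i + fv l i) / (1 + av l i * fv l i)) ^ (uA l i j)) :
    ∀ i j, j = i + 1 →
      (∀ k, s i (s j (s i (av l k))) = s j (s i (s j (av l k)))) ∧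
      (∀ k, s i (s j (s i (fv l k))) = s j (s i (s j (fv l k)))) := by
  rintro i j hj
  have hij : i ≠ j := hj ▸ Fin.ne_add_one (by omega) i
  have hij' : i ≠ j + 1 := hj ▸ Fin.ne_add_one_add_one hl i
  have ha := av_ne_zero l i
  have hb := av_ne_zero l j
  have σa : s i (av l i) = (av l i)⁻¹ := by
    rw [hsa, show cartanA l i i = 2 by simp [cartanA]]
    field_simp
  have τb : s j (av l j) = (av l j)⁻¹ := by
    rw [hsa, show cartanA l j j = 2 by simp [cartanA]]
    field_simp
  have σb : s i (av l j) = av l j * av l i := by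
    rw [hsa, show cartanA l i j = -1 by simp [cartanA, hij, ← hj], neg_neg, zpow_one]
  have τa : s j (av l i) = av l i * av l j := by
    rw [hsa, show cartanA l j i = -1 by simp [cartanA, hij.symm, ← hj], neg_neg, zpow_one]
  have σf : s i (fv l i) = fv l i := by
    rw [hsf, show uA l i i = 0 by simp [uA, Fin.ne_add_one (by omega : 1 ≤ l) i], zpow_zero,
      mul_one]
  have τg : s j (fv l j) = fv l j := by
    rw [hsf, show uA l j j = 0 by simp [uA, Fin.ne_add_one (by omega : 1 ≤ l) j], zpow_zero,
      mul_one]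
  have σg : s i (fv l j) =
      fv l j * ((av l i + fv l i) / (1 + av l i * fv l i)) := by
    rw [hsf, show uA l i j = 1 by simp [uA, ← hj], zpow_one]
  have τf : s j (fv l i) =
      fv l i * ((av l j + fv l j) / (1 + av l j * fv l j))⁻¹ := by
    rw [hsf, show uA l j i = -1 by simp [uA, hij', ← hj], zpow_neg_one]
  have στa : s i (s j (av l i)) = av l j := by
    rw [τa, map_mul, σa, σb]
    field_simp
  have τσb : s j (s i (av l j)) = av l i := by
    rw [σb, map_mul, τb, τa]
    field_simp
  have hP := ratio_mul_map_map_ratio (s i) (s j) ha hb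
    (one_add_av_mul_fv_ne_zero l i) (av_add_fv_ne_zero l j)
    σa σb σf σg τa τf
  have hQ := ratio_mul_map_map_ratio' (s j) (s i) hb ha (fv_ne_zero l j)
    (av_add_fv_ne_zero l j) (av_add_fv_ne_zero l i)
    τb τa τg τf σb σg
  refine ⟨fun k => ?_, fun k => ?_⟩
  · simp only [hsa _ k, map_mul, map_zpow₀, στa, τσb]
    simp only [σb, τa, mul_zpow]
    ring
  · have σk := hsf i k
    have τk := hsf j k
    generalize (av l i + fv l i) / (1 + av l i * fv l i) = P at hP σk
    generalize (av l j + fv l j) / (1 + av l j * fv l j) = Q at hQ τk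
    simp only [σk, τk, map_mul, map_zpow₀]
    generalize s i (s j P) = P' at hP ⊢
    generalize s j (s i Q) = Q' at hQ ⊢
    rw [← hP, ← hQ, mul_zpow, mul_zpow]
    ring
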